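/- Let v, δ be integers with 2 < δ < v - 1 and 4v = (δ+2)², and let F(x) = [x(v-1) - δ(δ-1) + √((x(v-1) - δ(δ-1))² + 4(v-δ-1)δ(v-2δ+x))] / (2(v-δ-1)). Then F((δ-2)/2) = (δ-2)/2, and F(x) > x for all x ≥ 0 with x ≠ (δ-2)/2. -/

import Mathlib

open scoped Classical

noncomputable section

/-- The second largest element (counted with multiplicity) of a finite family of reals. -/
def secondLargest {n : Type*} [Fintype n] (f : n → ℝ) : ℝ :=
  sSup {x : ℝ | ∃ i j : n, i ≠ j ∧ x = min (f i) (f j)}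

/-- The second smallest element (counted with multiplicity) of a finite family of reals. -/
def secondSmallest {n : Type*} [Fintype n] (f : n → ℝ) : ℝ :=
  sInf {x : ℝ | ∃ i j : n, i ≠ j ∧ x = max (f i) (f j)}

theorem adjMatrix_isHermitian {V : Type*} [Fintype V] (G : SimpleGraph V) :
    (G.adjMatrix ℝ).IsHermitian := by
  rw [Matrix.IsHermitian, Matrix.conjTranspose_eq_transpose_of_trivial]
  exact G.isSymm_adjMatrix

/-- The second largest eigenvalue `ν₂` of the adjacency matrix of a finite graph. -/
def nu2 {V : Type*} [Fintype V] [DecidableEq V] (G : SimpleGraph V) : ℝ :=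
  secondLargest (adjMatrix_isHermitian G).eigenvalues

/-- The algebraic connectivity of a finite graph: the second smallest eigenvalue of its
Laplacian matrix. -/
def algebraicConnectivity {V : Type*} [Fintype V] [DecidableEq V] (G : SimpleGraph V) : ℝ :=
  secondSmallest (SimpleGraph.posSemidef_lapMatrix ℝ G).1.eigenvalues

/-- The neighbourhood graph of a vertex `u`: the subgraph of `G` induced on the set of
neighbours of `u`. -/
abbrev nbhdGraph {V : Type*} (G : SimpleGraph V) (u : V) : SimpleGraph (G.neighborSet u) :=
  G.induce (G.neighborSet u)

/-- The average degree of a finite graph: the sum of the degrees of its vertices divided by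
the number of its vertices. -/
def avgDegree {W : Type*} [Fintype W] (H : SimpleGraph W) : ℝ :=
  (∑ w, (H.degree w : ℝ)) / (Fintype.card W : ℝ)

/-- The average degree of a connected component `C` of a finite graph `H`: the sum of the
degrees (taken within `H`) of the vertices of `C` divided by the number of vertices of `C`. -/
def compAvgDegree {W : Type*} [Fintype W] (H : SimpleGraph W) (C : H.ConnectedComponent) : ℝ :=
  (∑ w ∈ C.supp.toFinset, (H.degree w : ℝ)) / (C.supp.toFinset.card : ℝ)

/-- The function `F` of the paper (for parameters `v`, `δ`). -/
def F (v δ x : ℝ) : ℝ :=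
  (x * (v - 1) - δ * (δ - 1) +
      Real.sqrt ((x * (v - 1) - δ * (δ - 1)) ^ 2 + 4 * (v - δ - 1) * δ * (v - 2 * δ + x))) /
    (2 * (v - δ - 1))

end

/-- On the curve `4v = (δ+2)²`, the discriminant in `F` is a sum of two squares (with positive
weight when `v - δ - 1` and `δ` are positive). -/
theorem F_discriminant_eq {v δ : ℝ} (h : 4 * v = (δ + 2) ^ 2) (x : ℝ) :
    (x * (v - 1) - δ * (δ - 1)) ^ 2 + 4 * (v - δ - 1) * δ * (v - 2 * δ + x) =
      (2 * (v - δ - 1) * x - (x * (v - 1) - δ * (δ - 1))) ^ 2 +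
        4 * (v - δ - 1) * δ * (x - (δ - 2) / 2) ^ 2 := by
  obtain rfl : v = (δ + 2) ^ 2 / 4 := by linarith
  ring

/-- comparison of `F x` with `x` when `2 < δ < v - 1` and `4v = (δ+2)²`. -/
theorem F_vs_id_of_boundary (v δ : ℤ) (hδ₁ : 2 < δ) (hδ₂ : δ < v - 1)
    (hv4 : 4 * v = (δ + 2) ^ 2) :
    F (v : ℝ) (δ : ℝ) (((δ : ℝ) - 2) / 2) = ((δ : ℝ) - 2) / 2 ∧
    (∀ x : ℝ, 0 ≤ x → x ≠ ((δ : ℝ) - 2) / 2 → x < F (v : ℝ) (δ : ℝ) x) := by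
  have hd : (2 : ℝ) < δ := by exact_mod_cast hδ₁
  have hdv : (δ : ℝ) < v - 1 := by exact_mod_cast hδ₂
  have hv : 4 * (v : ℝ) = (δ + 2) ^ 2 := by exact_mod_cast hv4
  generalize (v : ℝ) = v at *
  generalize (δ : ℝ) = δ at *
  have ha : 0 < v - δ - 1 := by linarith
  refine ⟨?_, fun x _ hx => ?_⟩
  · have hnn : 0 ≤ 2 * (v - δ - 1) * ((δ - 2) / 2) - ((δ - 2) / 2 * (v - 1) - δ * (δ - 1)) := by
      nlinarith [mul_pos (sub_pos.2 hd) ha]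
    rw [F, F_discriminant_eq hv, sub_self, zero_pow two_ne_zero, mul_zero, add_zero,
      Real.sqrt_sq hnn, div_eq_iff (by positivity)]
    ring
  · have hpos : 0 < 4 * (v - δ - 1) * δ * (x - (δ - 2) / 2) ^ 2 := by
      have := sub_ne_zero.2 hx
      positivity
    rw [F, F_discriminant_eq hv, lt_div_iff₀ (by positivity)]
    have := Real.lt_sqrt_of_sq_lt (lt_add_of_pos_right
      ((2 * (v - δ - 1) * x - (x * (v - 1) - δ * (δ - 1))) ^ 2) hpos)
    linarith
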